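/- arXiv:1901.09109 — 3 statements merged into one kernel-verified Lean document; each statement's English description precedes it below -/
import Mathlib

section
/- Let β₁, β₂, β₃ ∈ [0,1) with η := β₁/√β₂ < 1, let α > 0 and α_t := α/√t, and let g_1,…,g_T ∈ ℝ^p be arbitrary vectors. Define coordinatewise m_0 = v_0 = v̂_0 = 0 and, for t ≥ 1, m_t := β₁ m_{t−1} + (1−β₁) g_t, v_t := β₂ v_{t−1} + (1−β₂) g_t ⊙ g_t, v̂_t := β₃ v̂_{t−1} + (1−β₃) max(v̂_{t−1}, v_t). Then ∑_{t=1}^T ∑_{d=1}^p α_t · m_{t,d}² / √(v̂_{t,d}) ≤ (α√(1+log T) / ((1−β₁)(1−η)·√((1−β₂)(1−β₃)))) · ∑_{d=1}^p ‖g_{1:T,d}‖, where ‖g_{1:T,d}‖ := (∑_{t=1}^T g_{t,d}²)^{1/2} and the convention 0/0 = 0 is used. -/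
open Finset in
/-- Exponential averaging does not increase a sum weighted by the decreasing weights `1 / √t`. -/
theorem sum_abs_div_sqrt_le_of_exp_average {β : ℝ} (hβ : 0 ≤ β) (hβ' : β < 1) {g m : ℕ → ℝ}
    (hm0 : m 0 = 0) (hm : ∀ t, m (t + 1) = β * m t + (1 - β) * g (t + 1)) (T : ℕ) :
    ∑ t ∈ Icc 1 T, |m t| / √t ≤ ∑ t ∈ Icc 1 T, |g t| / √t := by
  have key : (1 - β) * ∑ t ∈ Icc 1 T, |m t| / √t + β * (|m T| / √T) ≤
      (1 - β) * ∑ t ∈ Icc 1 T, |g t| / √t := by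
    induction T with
    | zero => simp
    | succ n ih =>
      rw [sum_Icc_succ_top (by omega), sum_Icc_succ_top (by omega)]
      have habs : |m (n + 1)| ≤ β * |m n| + (1 - β) * |g (n + 1)| := by
        rw [hm]
        refine (abs_add_le _ _).trans_eq ?_
        rw [abs_mul, abs_mul, abs_of_nonneg hβ, abs_of_pos (sub_pos.2 hβ')]
      have hdiv : |m (n + 1)| / √(n + 1 : ℕ) ≤
          β * (|m n| / √(n + 1 : ℕ)) + (1 - β) * (|g (n + 1)| / √(n + 1 : ℕ)) :=
        (div_le_div_of_nonneg_right habs (Real.sqrt_nonneg _)).trans_eq (by ring)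
      have hdecr : |m n| / √(n + 1 : ℕ) ≤ |m n| / √n := by
        rcases Nat.eq_zero_or_pos n with rfl | hn
        · simp [hm0]
        · have : (0 : ℝ) < n := by exact_mod_cast hn
          gcongr
          simp
      have := mul_le_mul_of_nonneg_left hdecr hβ
      linarith
  have hlast : 0 ≤ β * (|m T| / √T) := by positivity
  exact le_of_mul_le_mul_left (by linarith) (sub_pos.2 hβ')

open Finset in
theorem sum_abs_div_sqrt_le_sqrt_one_add_log_mul (g : ℕ → ℝ) (T : ℕ) :
    ∑ t ∈ Icc 1 T, |g t| / √t ≤ √(1 + Real.log T) * √(∑ t ∈ Icc 1 T, g t ^ 2) := by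
  have hharm : ∑ t ∈ Icc 1 T, (1 / √(t : ℝ)) ^ 2 ≤ 1 + Real.log T := by
    have h := harmonic_le_one_add_log T
    rw [harmonic_eq_sum_Icc] at h
    push_cast at h
    simpa using h
  calc ∑ t ∈ Icc 1 T, |g t| / √t = ∑ t ∈ Icc 1 T, (1 / √(t : ℝ)) * |g t| :=
        sum_congr rfl fun t _ => by ring
    _ ≤ √(∑ t ∈ Icc 1 T, (1 / √(t : ℝ)) ^ 2) * √(∑ t ∈ Icc 1 T, |g t| ^ 2) :=
        Real.sum_mul_le_sqrt_mul_sqrt _ _ _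
    _ ≤ √(1 + Real.log T) * √(∑ t ∈ Icc 1 T, g t ^ 2) := by
        simp only [sq_abs]
        gcongr

/-- The first moment is dominated by the square root of the averaged running maximum of the
second moment. -/
theorem sqrt_mul_abs_first_moment_le_sqrt {β₁ β₂ β₃ : ℝ} (hβ₁ : 0 ≤ β₁) (hβ₁' : β₁ < 1)
    (hβ₂ : 0 ≤ β₂) (hβ₂' : β₂ < 1) (hβ₃ : 0 ≤ β₃) (hβ₃' : β₃ < 1)
    {g m v vhat : ℕ → ℝ}
    (hm0 : m 0 = 0) (hv0 : v 0 = 0) (hvh0 : vhat 0 = 0)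
    (hm : ∀ t, m (t + 1) = β₁ * m t + (1 - β₁) * g (t + 1))
    (hv : ∀ t, v (t + 1) = β₂ * v t + (1 - β₂) * g (t + 1) ^ 2)
    (hvh : ∀ t, vhat (t + 1) = β₃ * vhat t + (1 - β₃) * max (vhat t) (v (t + 1)))
    (t : ℕ) :
    √((1 - β₂) * (1 - β₃)) * |m t| ≤ √(vhat t) := by
  have h₁ : 0 < 1 - β₁ := sub_pos.2 hβ₁'
  have h₂ : 0 < 1 - β₂ := sub_pos.2 hβ₂'
  have h₃ : 0 < 1 - β₃ := sub_pos.2 hβ₃'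
  have hmono : ∀ t, vhat t ≤ vhat (t + 1) := fun t => by
    rw [hvh]
    nlinarith [mul_le_mul_of_nonneg_left (le_max_left (vhat t) (v (t + 1))) h₃.le]
  have hvnn : ∀ t, 0 ≤ v t := fun t => by
    induction t with
    | zero => exact hv0.ge
    | succ n ih => rw [hv]; positivity
  have hvhnn : ∀ t, 0 ≤ vhat t := fun t => by
    induction t with
    | zero => exact hvh0.ge
    | succ n ih => exact ih.trans (hmono n)
  have hg : ∀ t, √((1 - β₂) * (1 - β₃)) * |g (t + 1)| ≤ √(vhat (t + 1)) := fun t => by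
    rw [← Real.sqrt_sq_eq_abs, ← Real.sqrt_mul (by positivity)]
    apply Real.sqrt_le_sqrt
    have hgv : (1 - β₂) * g (t + 1) ^ 2 ≤ v (t + 1) := by
      rw [hv]
      exact le_add_of_nonneg_left (mul_nonneg hβ₂ (hvnn t))
    have := mul_le_mul_of_nonneg_left (hgv.trans (le_max_right (vhat t) _)) h₃.le
    have := mul_nonneg hβ₃ (hvhnn t)
    rw [hvh]
    linarith
  induction t with
  | zero => simp [hm0]
  | succ n ih =>
    have habs : |m (n + 1)| ≤ β₁ * |m n| + (1 - β₁) * |g (n + 1)| := by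
      rw [hm]
      refine (abs_add_le _ _).trans_eq ?_
      rw [abs_mul, abs_mul, abs_of_nonneg hβ₁, abs_of_pos h₁]
    calc √((1 - β₂) * (1 - β₃)) * |m (n + 1)|
        ≤ √((1 - β₂) * (1 - β₃)) * (β₁ * |m n| + (1 - β₁) * |g (n + 1)|) := by gcongr
      _ = β₁ * (√((1 - β₂) * (1 - β₃)) * |m n|) +
          (1 - β₁) * (√((1 - β₂) * (1 - β₃)) * |g (n + 1)|) := by ring
      _ ≤ β₁ * √(vhat (n + 1)) + (1 - β₁) * √(vhat (n + 1)) := by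
        gcongr
        · exact ih.trans (Real.sqrt_le_sqrt (hmono n))
        · exact hg n
      _ = √(vhat (n + 1)) := by ring

theorem sq_div_le_abs_div_of_mul_abs_le {c x y : ℝ} (hc : 0 < c) (h : c * |x| ≤ y) :
    x ^ 2 / y ≤ |x| / c := by
  have hy : 0 ≤ y := (by positivity : 0 ≤ c * |x|).trans h
  rcases hy.eq_or_lt with rfl | hy
  · simp only [div_zero]
    positivity
  · rw [div_le_div_iff₀ hy hc, ← sq_abs]
    nlinarith [mul_le_mul_of_nonneg_left h (abs_nonneg x)]

/-- Lemma 3 of the paper: for the (coordinatewise) DADAM moment recursions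
with constant decay `β₁` and step sizes `α_t = α/√t`,
`∑_{t=1}^T ∑_{d=1}^p α_t m_{t,d}²/√(v̂_{t,d})
   ≤ (α√(1+log T)/((1−β₁)(1−η)√((1−β₂)(1−β₃)))) ∑_{d=1}^p ‖g_{1:T,d}‖`. -/
theorem dadam_momentum_sum_bound {p T : ℕ}
    (β₁ β₂ β₃ : ℝ)
    (hβ₁ : 0 ≤ β₁) (hβ₁' : β₁ < 1)
    (hβ₂ : 0 ≤ β₂) (hβ₂' : β₂ < 1)
    (hβ₃ : 0 ≤ β₃) (hβ₃' : β₃ < 1)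
    (hη : β₁ / Real.sqrt β₂ < 1)
    (α : ℝ) (hα : 0 < α)
    (g m v vhat : ℕ → Fin p → ℝ)
    (hm0 : ∀ d, m 0 d = 0) (hv0 : ∀ d, v 0 d = 0) (hvh0 : ∀ d, vhat 0 d = 0)
    (hm : ∀ t, 1 ≤ t → ∀ d, m t d = β₁ * m (t-1) d + (1-β₁) * g t d)
    (hv : ∀ t, 1 ≤ t → ∀ d, v t d = β₂ * v (t-1) d + (1-β₂) * (g t d)^2)
    (hvh : ∀ t, 1 ≤ t → ∀ d,
      vhat t d = β₃ * vhat (t-1) d + (1-β₃) * max (vhat (t-1) d) (v t d)) :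
    ∑ t ∈ Finset.Icc 1 T, ∑ d, (α / Real.sqrt t) * (m t d)^2 / Real.sqrt (vhat t d) ≤
      α * Real.sqrt (1 + Real.log T) /
        ((1 - β₁) * (1 - β₁ / Real.sqrt β₂) * Real.sqrt ((1-β₂) * (1-β₃))) *
        ∑ d, Real.sqrt (∑ t ∈ Finset.Icc 1 T, (g t d)^2) := by
  set c := Real.sqrt ((1 - β₂) * (1 - β₃))
  have hc0 : 0 < c := Real.sqrt_pos.2 (mul_pos (sub_pos.2 hβ₂') (sub_pos.2 hβ₃'))
  have hη0 : 0 ≤ β₁ / Real.sqrt β₂ := by positivity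
  set k := (1 - β₁) * (1 - β₁ / Real.sqrt β₂)
  have hk0 : 0 < k := mul_pos (sub_pos.2 hβ₁') (sub_pos.2 hη)
  have hk1 : k ≤ 1 := mul_le_one₀ (by linarith) (by linarith) (by linarith)
  rw [Finset.sum_comm, Finset.mul_sum]
  refine Finset.sum_le_sum fun d _ => ?_
  have hm' : ∀ t, m (t + 1) d = β₁ * m t d + (1 - β₁) * g (t + 1) d :=
    fun t => hm (t + 1) (by omega) d
  have hdom := sqrt_mul_abs_first_moment_le_sqrt (g := (g · d)) (m := (m · d)) (v := (v · d))
    (vhat := (vhat · d)) hβ₁ hβ₁' hβ₂ hβ₂' hβ₃ hβ₃' (hm0 d) (hv0 d) (hvh0 d) hm'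
    (fun t => hv (t + 1) (by omega) d) (fun t => hvh (t + 1) (by omega) d)
  calc ∑ t ∈ Finset.Icc 1 T, (α / Real.sqrt t) * (m t d)^2 / Real.sqrt (vhat t d)
      ≤ ∑ t ∈ Finset.Icc 1 T, α / c * (|m t d| / Real.sqrt t) := by
        refine Finset.sum_le_sum fun t _ => ?_
        have h := mul_le_mul_of_nonneg_left (sq_div_le_abs_div_of_mul_abs_le hc0 (hdom t))
          (by positivity : 0 ≤ α / Real.sqrt t)
        calc _ = _ := mul_div_assoc _ _ _
          _ ≤ _ := h
          _ = _ := by ring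
    _ = α / c * ∑ t ∈ Finset.Icc 1 T, |m t d| / Real.sqrt t := by rw [Finset.mul_sum]
    _ ≤ α / c * (Real.sqrt (1 + Real.log T) *
          Real.sqrt (∑ t ∈ Finset.Icc 1 T, (g t d)^2)) := by
        gcongr
        exact (sum_abs_div_sqrt_le_of_exp_average (m := (m · d)) (g := (g · d))
          hβ₁ hβ₁' (hm0 d) hm' T).trans (sum_abs_div_sqrt_le_sqrt_one_add_log_mul _ T)
    _ = α * Real.sqrt (1 + Real.log T) / c *
          Real.sqrt (∑ t ∈ Finset.Icc 1 T, (g t d)^2) := by ring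
    _ ≤ _ := by
        gcongr
        exact mul_le_of_le_one_left hc0.le hk1
end

section
/- Let β₁, β₂, β₃ ∈ [0,1) with η := β₁/√β₂ < 1, and let (g_t)_{t≥1} be an arbitrary real sequence. Define m_0 = v_0 = v̂_0 = 0 and, for t ≥ 1, m_t := β₁ m_{t−1} + (1−β₁) g_t, v_t := β₂ v_{t−1} + (1−β₂) g_t², v̂_t := β₃ v̂_{t−1} + (1−β₃) max(v̂_{t−1}, v_t). Then for every t ≥ 1: |m_t| ≤ √(v̂_t) / ((1−η)·√((1−β₂)(1−β₃))). -/
/-- scalar bound on the ratio of the DADAM first moment estimate to the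
square root of the second moment estimate:
`|m_t| ≤ √(v̂_t) / ((1−η)·√((1−β₂)(1−β₃)))` with `η = β₁/√β₂`. -/
theorem dadam_moment_ratio_bound
    (β₁ β₂ β₃ : ℝ)
    (hβ₁ : 0 ≤ β₁) (hβ₁' : β₁ < 1)
    (hβ₂ : 0 ≤ β₂) (hβ₂' : β₂ < 1)
    (hβ₃ : 0 ≤ β₃) (hβ₃' : β₃ < 1)
    (hη : β₁ / Real.sqrt β₂ < 1)
    (g m v vhat : ℕ → ℝ)
    (hm0 : m 0 = 0) (hv0 : v 0 = 0) (hvh0 : vhat 0 = 0)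
    (hm : ∀ t, 1 ≤ t → m t = β₁ * m (t-1) + (1-β₁) * g t)
    (hv : ∀ t, 1 ≤ t → v t = β₂ * v (t-1) + (1-β₂) * (g t)^2)
    (hvh : ∀ t, 1 ≤ t → vhat t = β₃ * vhat (t-1) + (1-β₃) * max (vhat (t-1)) (v t)) :
    ∀ t, 1 ≤ t →
      |m t| ≤ Real.sqrt (vhat t) /
        ((1 - β₁ / Real.sqrt β₂) * Real.sqrt ((1-β₂) * (1-β₃))) := by
  have hv_nonneg : ∀ t, 0 ≤ v t := by
    intro t
    induction t with
    | zero => exact hv0.ge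
    | succ t ih =>
      rw [hv (t + 1) (by omega), Nat.add_sub_cancel]
      have : 0 ≤ 1 - β₂ := by linarith
      positivity
  have hvh_step : ∀ t, vhat t ≤ vhat (t + 1) := by
    intro t
    rw [hvh (t + 1) (by omega), Nat.add_sub_cancel]
    nlinarith [le_max_left (vhat t) (v (t + 1))]
  have hvh_nonneg : ∀ t, 0 ≤ vhat t := fun t =>
    hvh0.ge.trans (monotone_nat_of_le_succ hvh_step (Nat.zero_le t))
  have hK : 0 < (1 - β₂) * (1 - β₃) := mul_pos (by linarith) (by linarith)
  have hsq : ∀ t, (1 - β₂) * (1 - β₃) * g (t + 1) ^ 2 ≤ vhat (t + 1) := by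
    intro t
    have h₁ : (1 - β₂) * g (t + 1) ^ 2 ≤ v (t + 1) := by
      rw [hv (t + 1) (by omega), Nat.add_sub_cancel]
      linarith [mul_nonneg hβ₂ (hv_nonneg t)]
    have h₂ : (1 - β₃) * v (t + 1) ≤ vhat (t + 1) := by
      rw [hvh (t + 1) (by omega), Nat.add_sub_cancel]
      nlinarith [le_max_right (vhat t) (v (t + 1)), mul_nonneg hβ₃ (hvh_nonneg t)]
    nlinarith
  have hg : ∀ t, |g (t + 1)| ≤ √(vhat (t + 1) / ((1 - β₂) * (1 - β₃))) := by
    intro t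
    apply Real.abs_le_sqrt
    rw [le_div_iff₀' hK]
    exact hsq t
  have hbound : ∀ t, |m t| ≤ √(vhat t / ((1 - β₂) * (1 - β₃))) := by
    intro t
    induction t with
    | zero => simp [hm0]
    | succ t ih =>
      have hmono : √(vhat t / ((1 - β₂) * (1 - β₃))) ≤
          √(vhat (t + 1) / ((1 - β₂) * (1 - β₃))) := by
        gcongr
        exact hvh_step t
      rw [hm (t + 1) (by omega), Nat.add_sub_cancel]
      calc |β₁ * m t + (1 - β₁) * g (t + 1)|
          ≤ |β₁ * m t| + |(1 - β₁) * g (t + 1)| := abs_add_le _ _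
        _ = β₁ * |m t| + (1 - β₁) * |g (t + 1)| := by
          rw [abs_mul, abs_mul, abs_of_nonneg hβ₁, abs_of_pos (sub_pos.2 hβ₁')]
        _ ≤ √(vhat (t + 1) / ((1 - β₂) * (1 - β₃))) := by
          nlinarith [hg t, ih.trans hmono]
  intro t _
  refine (hbound t).trans ?_
  rw [Real.sqrt_div (hvh_nonneg t)]
  have hη₀ : 0 ≤ β₁ / √β₂ := by positivity
  have hKs := Real.sqrt_pos.2 hK
  exact div_le_div_of_nonneg_left (Real.sqrt_nonneg _) (mul_pos (by linarith) hKs)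
    (mul_le_of_le_one_left hKs.le (by linarith))
end

section
/- Let β₂, β₃ ∈ [0,1), α > 0, and let g_1,…,g_T be an arbitrary real sequence. Define v_0 = v̂_0 = 0 and, for t ≥ 1, v_t := β₂ v_{t−1} + (1−β₂) g_t², v̂_t := β₃ v̂_{t−1} + (1−β₃) max(v̂_{t−1}, v_t). Then, with the convention 0/0 = 0, ∑_{t=1}^T (α/√t)·g_t²/√(v̂_t) ≤ (α·√(1+log T)/√((1−β₂)(1−β₃))) · ( ∑_{t=1}^T g_t² )^{1/2}. -/
/-- Cauchy–Schwarz against the square roots of the harmonic terms. -/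
theorem sum_div_sqrt_le_sqrt_one_add_log_mul (f : ℕ → ℝ) (T : ℕ) :
    ∑ t ∈ Finset.Icc 1 T, f t / Real.sqrt t ≤
      Real.sqrt (1 + Real.log T) * Real.sqrt (∑ t ∈ Finset.Icc 1 T, (f t) ^ 2) := by
  have hharm : ∑ t ∈ Finset.Icc 1 T, ((Real.sqrt t)⁻¹) ^ 2 ≤ 1 + Real.log T := by
    have h := harmonic_le_one_add_log T
    rw [harmonic_eq_sum_Icc] at h
    push_cast at h
    simpa only [inv_pow, Real.sq_sqrt (Nat.cast_nonneg _)] using h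
  calc
    ∑ t ∈ Finset.Icc 1 T, f t / Real.sqrt t
        = ∑ t ∈ Finset.Icc 1 T, (Real.sqrt t)⁻¹ * f t :=
      Finset.sum_congr rfl fun t _ => by rw [div_eq_inv_mul]
    _ ≤ Real.sqrt (∑ t ∈ Finset.Icc 1 T, ((Real.sqrt t)⁻¹) ^ 2) *
          Real.sqrt (∑ t ∈ Finset.Icc 1 T, (f t) ^ 2) :=
      Real.sum_mul_le_sqrt_mul_sqrt _ _ _
    _ ≤ _ := by gcongr

/-- If `c * x ^ 2 ≤ y` with `c > 0`, then `x ^ 2 / √y ≤ |x| / √c`. -/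
theorem sq_div_sqrt_le_abs_div_sqrt {c x y : ℝ} (hc : 0 < c) (h : c * x ^ 2 ≤ y) :
    x ^ 2 / Real.sqrt y ≤ |x| / Real.sqrt c := by
  have hs : Real.sqrt c * |x| ≤ Real.sqrt y := by
    rw [← Real.sqrt_sq_eq_abs, ← Real.sqrt_mul hc.le]
    exact Real.sqrt_le_sqrt h
  apply div_le_of_le_mul₀ (Real.sqrt_nonneg y) (by positivity)
  have hc' : 0 < Real.sqrt c := Real.sqrt_pos.2 hc
  calc
    x ^ 2 = |x| / Real.sqrt c * (Real.sqrt c * |x|) := by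
      rw [← sq_abs]
      field_simp
    _ ≤ |x| / Real.sqrt c * Real.sqrt y := by gcongr

/-- scalar bound on the step-size-weighted sum of squared gradients divided
by the square root of the DADAM second moment estimate, with step sizes `α_t = α/√t`:
`∑_{t=1}^T (α/√t)·g_t²/√(v̂_t) ≤ (α√(1+log T)/√((1−β₂)(1−β₃)))·(∑_{t=1}^T g_t²)^{1/2}`. -/
theorem dadam_weighted_gradient_sum_bound
    (β₂ β₃ : ℝ)
    (hβ₂ : 0 ≤ β₂) (hβ₂' : β₂ < 1)
    (hβ₃ : 0 ≤ β₃) (hβ₃' : β₃ < 1)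
    (α : ℝ) (hα : 0 < α) (T : ℕ)
    (g v vhat : ℕ → ℝ)
    (hv0 : v 0 = 0) (hvh0 : vhat 0 = 0)
    (hv : ∀ t, 1 ≤ t → v t = β₂ * v (t-1) + (1-β₂) * (g t)^2)
    (hvh : ∀ t, 1 ≤ t → vhat t = β₃ * vhat (t-1) + (1-β₃) * max (vhat (t-1)) (v t)) :
    ∑ t ∈ Finset.Icc 1 T, (α / Real.sqrt t) * (g t)^2 / Real.sqrt (vhat t) ≤
      α * Real.sqrt (1 + Real.log T) / Real.sqrt ((1-β₂) * (1-β₃)) *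
        Real.sqrt (∑ t ∈ Finset.Icc 1 T, (g t)^2) := by
  have hv_nonneg : ∀ t, 0 ≤ v t := by
    intro t
    induction t with
    | zero => exact hv0.ge
    | succ n ih =>
      rw [hv (n + 1) n.succ_pos, Nat.add_sub_cancel]
      have := mul_nonneg (sub_nonneg.2 hβ₂'.le) (sq_nonneg (g (n + 1)))
      positivity
  have hvh_nonneg : ∀ t, 0 ≤ vhat t := by
    intro t
    induction t with
    | zero => exact hvh0.ge
    | succ n ih =>
      rw [hvh (n + 1) n.succ_pos, Nat.add_sub_cancel]
      have := mul_nonneg (sub_nonneg.2 hβ₃'.le) (ih.trans (le_max_left _ (v (n + 1))))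
      positivity
  have hc : 0 < (1 - β₂) * (1 - β₃) := mul_pos (sub_pos.2 hβ₂') (sub_pos.2 hβ₃')
  have hlower : ∀ t, 1 ≤ t → (1 - β₂) * (1 - β₃) * g t ^ 2 ≤ vhat t := by
    intro t ht
    have h₂ : (1 - β₂) * g t ^ 2 ≤ v t := by
      rw [hv t ht]
      exact le_add_of_nonneg_left (mul_nonneg hβ₂ (hv_nonneg _))
    calc
      (1 - β₂) * (1 - β₃) * g t ^ 2 = (1 - β₃) * ((1 - β₂) * g t ^ 2) := by ring
      _ ≤ (1 - β₃) * max (vhat (t - 1)) (v t) :=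
        mul_le_mul_of_nonneg_left (h₂.trans (le_max_right _ _)) (sub_nonneg.2 hβ₃'.le)
      _ ≤ vhat t := by
        rw [hvh t ht]
        exact le_add_of_nonneg_left (mul_nonneg hβ₃ (hvh_nonneg _))
  calc
    ∑ t ∈ Finset.Icc 1 T, (α / Real.sqrt t) * (g t)^2 / Real.sqrt (vhat t)
        ≤ ∑ t ∈ Finset.Icc 1 T,
            α / Real.sqrt ((1 - β₂) * (1 - β₃)) * (|g t| / Real.sqrt t) := by
      refine Finset.sum_le_sum fun t ht => ?_
      have h := sq_div_sqrt_le_abs_div_sqrt hc (hlower t (Finset.mem_Icc.1 ht).1)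
      calc
        (α / Real.sqrt t) * (g t)^2 / Real.sqrt (vhat t)
            = (α / Real.sqrt t) * ((g t)^2 / Real.sqrt (vhat t)) := mul_div_assoc _ _ _
        _ ≤ (α / Real.sqrt t) * (|g t| / Real.sqrt ((1 - β₂) * (1 - β₃))) := by gcongr
        _ = _ := by ring
    _ = α / Real.sqrt ((1 - β₂) * (1 - β₃)) *
          ∑ t ∈ Finset.Icc 1 T, |g t| / Real.sqrt t := (Finset.mul_sum _ _ _).symm
    _ ≤ α / Real.sqrt ((1 - β₂) * (1 - β₃)) *
          (Real.sqrt (1 + Real.log T) * Real.sqrt (∑ t ∈ Finset.Icc 1 T, |g t| ^ 2)) := by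
      gcongr
      exact sum_div_sqrt_le_sqrt_one_add_log_mul (fun t => |g t|) T
    _ = _ := by
      simp only [sq_abs]
      ring
end
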